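/- Let (M,d), τ_1,…,τ_N, p_1,…,p_N, μ, σ be as in the iterated function system representation, i.e., μ = ∑ p_i (μ∘τ_i^{-1}), μ(τ_i(M)∩τ_j(M)) = 0 for i ≠ j, ⋃ τ_i(M) = M, σ∘τ_i = id_M, and S_i f = p_i^{-1/2} χ_{τ_i(M)} (f∘σ) on L²(μ). Then for every nonempty finite word f = (i_1,…,i_k) in {1,…,N}, the projection S_{i_1}⋯S_{i_k} S_{i_k}*⋯S_{i_1}* equals the operator of multiplication by the indicator function of the set τ_{i_1}∘τ_{i_2}∘⋯∘τ_{i_k}(M) on L²(μ). -/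

import Mathlib

open MeasureTheory ContinuousLinearMap

/-- `S_f = S_{i₁} S_{i₂} ⋯ S_{i_k}` for a finite word `f = (i₁,…,i_k)`. -/
noncomputable def SWordLp {M : Type*} [MeasurableSpace M] {μ : Measure M} {N : ℕ}
    (S : Fin N → (Lp ℂ 2 μ →L[ℂ] Lp ℂ 2 μ)) (f : List (Fin N)) :
    Lp ℂ 2 μ →L[ℂ] Lp ℂ 2 μ :=
  (f.map S).prod

/-- `τ_f = τ_{i₁} ∘ τ_{i₂} ∘ ⋯ ∘ τ_{i_k}` for a finite word `f = (i₁,…,i_k)`. -/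
def wordMap {M : Type*} {N : ℕ} (τ : Fin N → M → M) : List (Fin N) → M → M
  | [] => _root_.id
  | i :: f => τ i ∘ wordMap τ f

/-- In the iterated function system representation of the Cuntz algebra `𝒪_N` on
`L²(μ)` (with `Sᵢ f = pᵢ^{-1/2} χ_{τᵢ(M)} (f ∘ σ)`), for every nonempty finite word
`f = (i₁,…,i_k)` the projection `S_{i₁}⋯S_{i_k} S_{i_k}^*⋯S_{i₁}^*` is the operator
of multiplication by the indicator function of `τ_{i₁}∘⋯∘τ_{i_k}(M)`. -/
theorem ifs_cuntz_word_projection_is_indicator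
    {M : Type*} [MetricSpace M] [CompactSpace M] [Nonempty M]
    [MeasurableSpace M] [BorelSpace M]
    (N : ℕ) (hN : 2 ≤ N) (τ : Fin N → M → M)
    (hτ : ∀ i, ∃ c : NNReal, c < 1 ∧ LipschitzWith c (τ i))
    (p : Fin N → ℝ) (hp : ∀ i, 0 < p i) (hpsum : ∑ i, p i = 1)
    (μ : Measure M) [IsProbabilityMeasure μ]
    (hself : ∀ B : Set M, MeasurableSet B →
      μ B = ∑ i : Fin N, ENNReal.ofReal (p i) * μ (τ i ⁻¹' B))
    (hno : ∀ i j : Fin N, i ≠ j → μ (Set.range (τ i) ∩ Set.range (τ j)) = 0)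
    (hcover : (⋃ i : Fin N, Set.range (τ i)) = Set.univ)
    (σ : M → M) (hσ : Measurable σ) (hστ : ∀ i, σ ∘ τ i = _root_.id)
    (S : Fin N → (Lp ℂ 2 μ →L[ℂ] Lp ℂ 2 μ))
    (hS : ∀ (i : Fin N) (f : Lp ℂ 2 μ),
      (S i f : M → ℂ) =ᵐ[μ] fun x =>
        ((Real.sqrt (p i) : ℂ))⁻¹ *
          Set.indicator (Set.range (τ i)) (fun _ => (1 : ℂ)) x * f (σ x))
    (hiso : ∀ i j : Fin N, adjoint (S i) * S j = if i = j then 1 else 0)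
    (hsum : (∑ i : Fin N, S i * adjoint (S i)) = 1) :
    ∀ f : List (Fin N), f ≠ [] → ∀ g : Lp ℂ 2 μ,
      ((SWordLp S f * adjoint (SWordLp S f)) g : M → ℂ) =ᵐ[μ]
        (Set.range (wordMap τ f)).indicator (g : M → ℂ) := by
  have hmp : MeasurePreserving σ μ μ := by
    refine ⟨hσ, ?_⟩
    ext B hB
    rw [Measure.map_apply hσ hB, hself _ (hσ hB)]
    have h1 : ∀ i, τ i ⁻¹' (σ ⁻¹' B) = B := by
      intro i
      rw [← Set.preimage_comp, hστ i, Set.preimage_id]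
    simp only [h1]
    rw [← Finset.sum_mul, ← ENNReal.ofReal_sum_of_nonneg (fun i _ => (hp i).le), hpsum]
    simp
  have hdisj : ∀ i j : Fin N, i ≠ j →
      ∀ᵐ x ∂μ, x ∈ Set.range (τ i) → x ∉ Set.range (τ j) := by
    intro i j hij
    filter_upwards [measure_eq_zero_iff_ae_notMem.1 (hno i j hij)] with x hx h1 h2
    exact hx ⟨h1, h2⟩
  have hproj : ∀ (i : Fin N) (g : Lp ℂ 2 μ),
      (S i (adjoint (S i) g) : M → ℂ) =ᵐ[μ] (Set.range (τ i)).indicator (g : M → ℂ) := by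
    intro i g
    have hg : g = ∑ j : Fin N, S j (adjoint (S j) g) := by
      have := congrArg (fun T : Lp ℂ 2 μ →L[ℂ] Lp ℂ 2 μ => T g) hsum
      simpa [ContinuousLinearMap.sum_apply] using this.symm
    have hg2 : (g : M → ℂ) =ᵐ[μ] fun x => ∑ j : Fin N, (S j (adjoint (S j) g) : M → ℂ) x := by
      have h3 := Lp.coeFn_finsetSum Finset.univ (fun j : Fin N => S j (adjoint (S j) g))
      rw [← hg] at h3
      filter_upwards [h3] with x hx
      rw [hx]; simp
    have hall : ∀ᵐ x ∂μ, ∀ j, (S j (adjoint (S j) g) : M → ℂ) x = ((Real.sqrt (p j) : ℂ))⁻¹ *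
          Set.indicator (Set.range (τ j)) (fun _ => (1 : ℂ)) x * (adjoint (S j) g) (σ x) :=
      ae_all_iff.2 fun j => hS j _
    have hd : ∀ᵐ x ∂μ, ∀ j, i ≠ j → x ∈ Set.range (τ i) → x ∉ Set.range (τ j) := by
      refine ae_all_iff.2 fun j => ?_
      by_cases hij : i = j
      · simp [hij]
      · filter_upwards [hdisj i j hij] with x hx _ using hx
    filter_upwards [hg2, hall, hd] with x h1 h2 h3
    by_cases hx : x ∈ Set.range (τ i)
    · rw [Set.indicator_of_mem hx, h1]
      symm
      apply Finset.sum_eq_single i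
      · intro j _ hj
        rw [h2 j, Set.indicator_of_notMem (h3 j hj.symm hx)]
        simp
      · simp
    · rw [Set.indicator_of_notMem hx, h2 i, Set.indicator_of_notMem hx]
      simp
  have main : ∀ (f : List (Fin N)) (g : Lp ℂ 2 μ),
      ((SWordLp S f * adjoint (SWordLp S f)) g : M → ℂ) =ᵐ[μ]
        (Set.range (wordMap τ f)).indicator (g : M → ℂ) := by
    intro f
    induction f with
    | nil =>
      intro g
      have h0 : (SWordLp S [] * adjoint (SWordLp S [])) g = g := by
        have h1 : adjoint (1 : Lp ℂ 2 μ →L[ℂ] Lp ℂ 2 μ) = 1 := by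
          rw [← ContinuousLinearMap.star_eq_adjoint, star_one]
        simp [SWordLp, h1]
      rw [h0]
      simp [wordMap]
    | cons i f ih =>
      intro g
      have h0 : (SWordLp S (i :: f) * adjoint (SWordLp S (i :: f))) g =
          S i ((SWordLp S f * adjoint (SWordLp S f)) (adjoint (S i) g)) := by
        have h1 : SWordLp S (i :: f) = S i * SWordLp S f := by simp [SWordLp]
        rw [h1, ← ContinuousLinearMap.star_eq_adjoint, star_mul]
        simp [ContinuousLinearMap.star_eq_adjoint]
      rw [h0]
      have h2 := hmp.quasiMeasurePreserving.ae_eq_comp (ih (adjoint (S i) g))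
      filter_upwards [hS i ((SWordLp S f * adjoint (SWordLp S f)) (adjoint (S i) g)), h2,
        hS i (adjoint (S i) g), hproj i g] with x e1 e2 e3 e4
      simp only [Function.comp_apply] at e2
      rw [e1, e2]
      by_cases hx : x ∈ Set.range (τ i)
      · have key : x ∈ Set.range (wordMap τ (i :: f)) ↔ σ x ∈ Set.range (wordMap τ f) := by
          obtain ⟨y, rfl⟩ := hx
          have hy : ∀ z, σ (τ i z) = z := fun z => congrFun (hστ i) z
          rw [hy]
          constructor
          · rintro ⟨z, hz⟩
            refine ⟨z, ?_⟩
            have := congrArg σ hz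
            simpa [wordMap, hy] using this
          · rintro ⟨z, rfl⟩
            exact ⟨z, rfl⟩
        rw [Set.indicator_of_mem hx] at e4
        by_cases hw : σ x ∈ Set.range (wordMap τ f)
        · rw [Set.indicator_of_mem hw, Set.indicator_of_mem (key.2 hw), ← e4, e3]
        · rw [Set.indicator_of_notMem hw, Set.indicator_of_notMem (fun h => hw (key.1 h))]
          simp
      · have hw : x ∉ Set.range (wordMap τ (i :: f)) := by
          rintro ⟨z, rfl⟩
          exact hx ⟨_, rfl⟩
        rw [Set.indicator_of_notMem hx, Set.indicator_of_notMem hw]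
        simp
  exact fun f _ g => main f g
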